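/- Let m ≥ 1 and a, b_1,…,b_m, c_1,…,c_m ∈ ℂ with a ≠ 0, β_{0,i} = b_i ≠ 0, β_{1,i} = c_i − 1 − b_i ≠ 0 for all i, and γ_w = a − Σ_i w_i c_i + |w| ≠ 0 for all w ∈ {0,1}^m. Let C, (e_v), f_v, Πβ_v, R_k be as follows: C_{v,v'} = Σ_w A_w ∏_{i: w_i=0} δ(v_i,v'_i)/β_{v_i,i} (A_w the chain sum, A_{(0,…,0)}=1); (e_v) the standard row basis; f_v = ((a − Σ_i β_{v_i,i})/a) e_v − Σ_j (β_{1−v_j,j}/a) e_{σ_j·v}; Πβ_v = ∏_i β_{v_i,i}; (R_k)_{v,v} = −β_{v_k,k}, (R_k)_{v,σ_k·v} = −β_{1−v_k,k}, other entries 0. Then for every k ∈ {1,…,m} and every x ∈ ℂ^m with x_k ≠ 0 and 1 − Σ_i v_i x_i ≠ 0 for all v ∈ {0,1}^m, the following matrix identity holds: (1/x_k)·R_k + Σ_{v: v_k = 1} (a/(1 − Σ_i v_i x_i))·e_vᵀ·f_v = (1/x_k)·[ (1 − c_k)·I_{2^m} + Σ_{v: v_k = 0} β_{1,k}·Πβ_v·(C·(f_v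 − f_{σ_k·v})ᵀ)·(e_v − e_{σ_k·v}) ] + Σ_{v∈{0,1}^m} v_k·(a·Πβ_v/(1 − Σ_i v_i x_i))·(C·f_vᵀ)·f_v, where e_vᵀ·f_v, (C·u)·(r) denote outer products of a column vector with a row vector. -/

import Mathlib

open Finset
open scoped Classical

/-- `v_i ∈ {0,1}` regarded as a complex number. -/
noncomputable def bval (s : Bool) : ℂ := if s then 1 else 0

/-- The parameters `β_{0,i} = b_i`, `β_{1,i} = c_i − 1 − b_i`. -/
noncomputable def betaP {m : ℕ} (b c : Fin m → ℂ) (s : Bool) (i : Fin m) : ℂ :=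
  if s then c i - 1 - b i else b i

/-- `σ_k·v` : flip the `k`-th coordinate of `v`. -/
def flipv {m : ℕ} (k : Fin m) (v : Fin m → Bool) : Fin m → Bool :=
  Function.update v k (!(v k))

/-- The weight `|v| = Σ v_i` of `v ∈ {0,1}^m`. -/
def wt {m : ℕ} (v : Fin m → Bool) : ℕ := ∑ i, if v i then 1 else 0

/-- `γ_w = a − Σ_i w_i c_i + |w|`. -/
noncomputable def gammaP {m : ℕ} (a : ℂ) (c : Fin m → ℂ) (w : Fin m → Bool) : ℂ :=
  a - ∑ i, (if w i then c i else 0) + (wt w : ℂ)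

/-- `A_w = Σ ∏_{j=1}^r 1/γ_{w^{(j)}}`, the sum over all chains
`w = w^{(r)} ≻ w^{(r−1)} ≻ ⋯ ≻ w^{(1)}` with `|w^{(j)}| = j` (here `r = |w|`;
a chain is encoded as `ch : Fin r → {0,1}^m` with `ch j = w^{(j+1)}`, the conditions
on weights making the inclusions automatically strict);
for `w = (0,…,0)` the empty chain gives `A_w = 1`. -/
noncomputable def Aw {m : ℕ} (γ : (Fin m → Bool) → ℂ) (w : Fin m → Bool) : ℂ :=
  ∑ ch ∈ (univ : Finset (Fin (wt w) → Fin m → Bool)).filter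
      (fun ch =>
        (∀ j : Fin (wt w), wt (ch j) = j.val + 1) ∧
        (∀ j : Fin (wt w), j.val = wt w - 1 → ch j = w) ∧
        (∀ j j' : Fin (wt w), j'.val = j.val + 1 →
          ∀ i, ch j i = true → ch j' i = true)),
    ∏ j, 1 / γ (ch j)

/-- The intersection matrix `C` with entries
`C_{v,v'} = Σ_w A_w · ∏_{i : w_i = 0} δ(v_i, v'_i)/β_{v_i,i}`. -/
noncomputable def Cmat {m : ℕ} (a : ℂ) (b c : Fin m → ℂ) :
    Matrix (Fin m → Bool) (Fin m → Bool) ℂ :=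
  fun v v' => ∑ w, Aw (gammaP a c) w *
    ∏ i ∈ univ.filter (fun i => w i = false),
      (if v i = v' i then 1 else 0) / betaP b c (v i) i

/-- `Σβ_v = Σ_i β_{v_i,i}`. -/
noncomputable def Sbeta {m : ℕ} (b c : Fin m → ℂ) (v : Fin m → Bool) : ℂ :=
  ∑ i, betaP b c (v i) i

/-- `Πβ_v = ∏_i β_{v_i,i}`. -/
noncomputable def Pbeta {m : ℕ} (b c : Fin m → ℂ) (v : Fin m → Bool) : ℂ :=
  ∏ i, betaP b c (v i) i

/-- The standard basis row vector `e_v` of `ℂ^{2^m}`, `(e_v)_w = δ_{v,w}`. -/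
noncomputable def evec {m : ℕ} (v : Fin m → Bool) : (Fin m → Bool) → ℂ :=
  fun w => if w = v then 1 else 0

/-- The coordinate row vector `f_v = ((a − Σβ_v)/a) e_v − Σ_j (β_{1−v_j,j}/a) e_{σ_j·v}`
of the class `ψ_v` in the frame `(φ_v)`. -/
noncomputable def fvec {m : ℕ} (a : ℂ) (b c : Fin m → ℂ) (v : Fin m → Bool) :
    (Fin m → Bool) → ℂ :=
  ((a - Sbeta b c v) / a) • evec v - ∑ j, (betaP b c (!(v j)) j / a) • evec (flipv j v)

/-- The residue matrix `R_k`: `(R_k)_{v,v} = −β_{v_k,k}`, `(R_k)_{v,σ_k·v} = −β_{1−v_k,k}`,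
all other entries `0`. -/
noncomputable def Rmat {m : ℕ} (b c : Fin m → ℂ) (k : Fin m) :
    Matrix (Fin m → Bool) (Fin m → Bool) ℂ :=
  fun v w =>
    if w = v then -betaP b c (v k) k
    else if w = flipv k v then -betaP b c (!(v k)) k
    else 0

theorem flipv_same {m : ℕ} (j : Fin m) (v : Fin m → Bool) : flipv j v j = !(v j) := by
  simp [flipv]

theorem flipv_of_ne {m : ℕ} {i j : Fin m} (h : i ≠ j) (v : Fin m → Bool) :
    flipv j v i = v i := by
  simp [flipv, h]

theorem flipv_involutive {m : ℕ} (j : Fin m) : Function.Involutive (flipv j) := by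
  intro v
  simp [flipv]

theorem flipv_ne {m : ℕ} (j : Fin m) (v : Fin m → Bool) : flipv j v ≠ v := by
  intro h
  simpa [flipv_same] using congrFun h j

theorem flipv_index_injective {m : ℕ} (v : Fin m → Bool) :
    Function.Injective fun j => flipv j v := by
  intro i j h
  by_contra hij
  simpa [flipv_same, flipv_of_ne hij] using congrFun h i

theorem wt_eq_card {m : ℕ} (v : Fin m → Bool) : wt v = #{i | v i = true} := by
  simp [wt]

theorem wt_flipv {m : ℕ} {j : Fin m} {v : Fin m → Bool} (h : v j = true) :
    wt (flipv j v) + 1 = wt v := by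
  have hs : ({i | flipv j v i = true} : Finset (Fin m)) = ({i | v i = true} : Finset _).erase j := by
    ext i
    by_cases hi : i = j
    · subst hi
      simp [flipv_same, h]
    · simp [flipv_of_ne hi, hi]
  rw [wt_eq_card, wt_eq_card, hs, card_erase_add_one (by simpa using h)]

theorem eq_false_of_wt_eq_zero {m : ℕ} {v : Fin m → Bool} (h : wt v = 0) (i : Fin m) :
    v i = false := by
  rw [wt_eq_card, card_eq_zero, filter_eq_empty_iff] at h
  simpa using h (mem_univ i)

theorem exists_flipv_eq {m : ℕ} {p v : Fin m → Bool} (hle : ∀ i, p i = true → v i = true)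
    (hwt : wt p + 1 = wt v) : ∃ j, v j = true ∧ flipv j v = p := by
  rw [wt_eq_card, wt_eq_card] at hwt
  obtain ⟨j, hj, hins⟩ := exists_eq_insert_iff.2
    ⟨fun i hi => by simpa using hle i (by simpa using hi), hwt⟩
  have hmem : ∀ i, v i = true ↔ i = j ∨ p i = true := fun i => by
    have := Finset.ext_iff.1 hins i
    simp only [mem_insert, mem_filter, mem_univ, true_and] at this
    exact this.symm
  refine ⟨j, (hmem j).2 (Or.inl rfl), funext fun i => ?_⟩
  by_cases hi : i = j
  · subst hi
    have hv := (hmem i).2 (Or.inl rfl)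
    simp only [mem_filter, mem_univ, true_and] at hj
    simp [flipv_same, hv, hj]
  · rw [flipv_of_ne hi, Bool.eq_iff_iff, hmem i]
    simp [hi]

/-- The chains `w^{(1)} ≺ ⋯ ≺ w^{(r)} = w` summed over in `Aw`, for a free length `r`. -/
noncomputable def weightChains {m : ℕ} (r : ℕ) (w : Fin m → Bool) :
    Finset (Fin r → Fin m → Bool) :=
  univ.filter fun ch =>
    (∀ j : Fin r, wt (ch j) = j.val + 1) ∧
    (∀ j : Fin r, j.val = r - 1 → ch j = w) ∧
    (∀ j j' : Fin r, j'.val = j.val + 1 → ∀ i, ch j i = true → ch j' i = true)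

theorem Aw_eq_sum_weightChains {m : ℕ} (γ : (Fin m → Bool) → ℂ) {r : ℕ} {w : Fin m → Bool}
    (h : wt w = r) : Aw γ w = ∑ ch ∈ weightChains r w, ∏ j, 1 / γ (ch j) := by
  subst h
  rfl

theorem snoc_mem_weightChains {m r : ℕ} {w : Fin m → Bool} (hw : wt w = r + 1) {j : Fin m}
    (hj : w j = true) {ch : Fin r → Fin m → Bool} (hch : ch ∈ weightChains r (flipv j w)) :
    (Fin.snoc ch w : Fin (r + 1) → Fin m → Bool) ∈ weightChains (r + 1) w := by
  simp only [weightChains, mem_filter, mem_univ, true_and] at hch ⊢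
  obtain ⟨hwt, hlast, hmono⟩ := hch
  refine ⟨fun l => ?_, fun l hl => ?_, fun l l' hll i => ?_⟩
  · induction l using Fin.lastCases with
    | last => simpa using hw
    | cast l => simpa using hwt l
  · have : l = Fin.last r := Fin.ext (by simpa using hl)
    simp [this]
  · induction l using Fin.lastCases with
    | last => exact absurd l'.isLt (by simp at hll; omega)
    | cast l =>
      induction l' using Fin.lastCases with
      | last =>
        simp only [Fin.val_last, Fin.val_castSucc] at hll
        rw [Fin.snoc_castSucc, Fin.snoc_last, hlast l (by omega)]
        by_cases hi : i = j
        · subst hi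
          exact fun _ => hj
        · rw [flipv_of_ne hi]
          exact id
      | cast l' =>
        rw [Fin.snoc_castSucc, Fin.snoc_castSucc]
        exact hmono l l' (by simpa using hll) i

theorem exists_init_mem_weightChains {m r : ℕ} {w : Fin m → Bool} (hw : wt w = r + 1)
    {ch : Fin (r + 1) → Fin m → Bool} (hch : ch ∈ weightChains (r + 1) w) :
    ch (Fin.last r) = w ∧
      ∃ j, w j = true ∧ (fun l : Fin r => ch l.castSucc) ∈ weightChains r (flipv j w) := by
  simp only [weightChains, mem_filter, mem_univ, true_and] at hch ⊢
  obtain ⟨hwt, hlast, hmono⟩ := hch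
  have hl : ch (Fin.last r) = w := hlast _ (by simp)
  refine ⟨hl, ?_⟩
  rcases r with _ | r
  · obtain ⟨j, hj, -⟩ := exists_flipv_eq (p := fun _ => false) (v := w) (by simp)
      (by rw [hw, add_left_inj]; simp [wt])
    exact ⟨j, hj, fun l => l.elim0, fun l => l.elim0, fun l => l.elim0⟩
  · obtain ⟨j, hj, hp⟩ := exists_flipv_eq (p := ch (Fin.last r).castSucc) (v := w)
      (fun i hi => hl ▸ hmono (Fin.last r).castSucc (Fin.last (r + 1)) (by simp) i hi)
      (by simp [hw, hwt])
    refine ⟨j, hj, fun l => by simpa using hwt l.castSucc, fun l hlr => ?_,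
      fun l l' hll => hmono _ _ (by simpa using hll)⟩
    have : l = Fin.last r := Fin.ext (by simpa using hlr)
    rw [this, hp]

theorem index_unique_of_mem_weightChains {m r : ℕ} {w : Fin m → Bool} (hw : wt w = r + 1)
    {j j' : Fin m} (hj : w j = true) (hj' : w j' = true) {ch : Fin r → Fin m → Bool}
    (h : ch ∈ weightChains r (flipv j w)) (h' : ch ∈ weightChains r (flipv j' w)) : j = j' := by
  apply flipv_index_injective w
  rcases r with _ | r
  · have hz : ∀ {l}, w l = true → wt (flipv l w) = 0 := fun hl => by
      have := wt_flipv hl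
      omega
    funext i
    simp only [eq_false_of_wt_eq_zero (hz hj), eq_false_of_wt_eq_zero (hz hj')]
  · simp only [weightChains, mem_filter, mem_univ, true_and] at h h'
    exact (h.2.1 (Fin.last r) (by simp)).symm.trans (h'.2.1 (Fin.last r) (by simp))

theorem Aw_of_wt_eq_zero {m : ℕ} (γ : (Fin m → Bool) → ℂ) {w : Fin m → Bool} (h : wt w = 0) :
    Aw γ w = 1 := by
  rw [Aw_eq_sum_weightChains γ h]
  simp [weightChains]

theorem Aw_recursion {m : ℕ} {γ : (Fin m → Bool) → ℂ} {w : Fin m → Bool} (hγ : γ w ≠ 0)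
    (h : wt w ≠ 0) : Aw γ w * γ w = ∑ j, if w j = true then Aw γ (flipv j w) else 0 := by
  obtain ⟨r, hr⟩ := Nat.exists_eq_succ_of_ne_zero h
  have hstep : ∀ j ∈ univ.filter (fun j => w j = true),
      Aw γ (flipv j w) = ∑ ch ∈ weightChains r (flipv j w), ∏ l, 1 / γ (ch l) := fun j hj =>
    Aw_eq_sum_weightChains γ (by
      have := wt_flipv (mem_filter.1 hj).2
      omega)
  rw [← sum_filter, sum_congr rfl hstep, sum_sigma', Aw_eq_sum_weightChains γ hr, sum_mul]
  symm
  refine sum_bij (fun p _ => (Fin.snoc p.2 w : Fin (r + 1) → Fin m → Bool)) ?_ ?_ ?_ ?_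
  · rintro ⟨j, ch⟩ hp
    simp only [mem_sigma, mem_filter, mem_univ, true_and] at hp
    exact snoc_mem_weightChains hr hp.1 hp.2
  · rintro ⟨j, ch⟩ hp ⟨j', ch'⟩ hp' heq
    simp only [mem_sigma, mem_filter, mem_univ, true_and] at hp hp'
    obtain rfl : ch = ch' := (Fin.snoc_inj.1 heq).1
    rw [index_unique_of_mem_weightChains hr hp.1 hp'.1 hp.2 hp'.2]
  · intro ch hch
    obtain ⟨hl, j, hj, hmem⟩ := exists_init_mem_weightChains hr hch
    refine ⟨⟨j, fun l => ch l.castSucc⟩, by simp [hj, hmem], ?_⟩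
    subst hl
    exact Fin.snoc_init_self ch
  · rintro ⟨j, ch⟩ -
    simp only [Fin.prod_univ_castSucc, Fin.snoc_castSucc, Fin.snoc_last]
    rw [mul_assoc, one_div_mul_cancel hγ, mul_one]

/-- The `w`-summand of `Cmat`, without its coefficient `Aw`. -/
noncomputable def deltaProd {m : ℕ} (b c : Fin m → ℂ) (w u v : Fin m → Bool) : ℂ :=
  ∏ i ∈ univ.filter (fun i => w i = false), (if u i = v i then 1 else 0) / betaP b c (u i) i

theorem betaP_ne_zero {m : ℕ} {b c : Fin m → ℂ} (hb0 : ∀ i, betaP b c false i ≠ 0)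
    (hb1 : ∀ i, betaP b c true i ≠ 0) (s : Bool) (i : Fin m) : betaP b c s i ≠ 0 := by
  cases s
  exacts [hb0 i, hb1 i]

theorem betaP_add_betaP_not {m : ℕ} (b c : Fin m → ℂ) (s : Bool) (i : Fin m) :
    betaP b c s i + betaP b c (!s) i = c i - 1 := by
  cases s <;> simp [betaP]

theorem deltaProd_flip_add {m : ℕ} {b c : Fin m → ℂ} (hb : ∀ s i, betaP b c s i ≠ 0)
    (w u v : Fin m → Bool) (j : Fin m) :
    betaP b c (v j) j * deltaProd b c w u v +
        betaP b c (!(v j)) j * deltaProd b c w u (flipv j v) =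
      if w j = true then (c j - 1) * deltaProd b c w u v else deltaProd b c (flipv j w) u v := by
  by_cases hj : w j = true
  · have : deltaProd b c w u (flipv j v) = deltaProd b c w u v := by
      refine prod_congr rfl fun i hi => ?_
      have hij : i ≠ j := by
        rintro rfl
        simp [hj] at hi
      rw [flipv_of_ne hij]
    rw [this, if_pos hj, ← add_mul, betaP_add_betaP_not]
  · have hjmem : j ∈ univ.filter (fun i => w i = false) := by simpa using hj
    have hw : univ.filter (fun i => flipv j w i = false) =
        (univ.filter (fun i => w i = false)).erase j := by
      ext i
      by_cases hi : i = j
      · subst hi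
        simp [flipv_same, hj]
      · simp [flipv_of_ne hi, hi]
    have hv : ∀ i ∈ (univ.filter (fun i => w i = false)).erase j,
        (if u i = flipv j v i then (1 : ℂ) else 0) / betaP b c (u i) i =
          (if u i = v i then 1 else 0) / betaP b c (u i) i := fun i hi => by
      rw [flipv_of_ne (ne_of_mem_erase hi)]
    rw [if_neg hj, deltaProd, deltaProd, deltaProd, hw, ← mul_prod_erase _ _ hjmem,
      ← mul_prod_erase _ _ hjmem, prod_congr rfl hv, flipv_same]
    have h0 := hb (v j) j
    have h1 := hb (!(v j)) j
    by_cases huv : u j = v j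
    · simp [huv, h0]
    · have huv' : u j = !(v j) := by
        cases h : u j <;> cases h' : v j <;> simp_all
      simp [huv', h1]

theorem deltaProd_of_wt_eq_zero {m : ℕ} (b c : Fin m → ℂ) {w : Fin m → Bool} (h : wt w = 0)
    (u v : Fin m → Bool) : deltaProd b c w u v = if u = v then 1 / Pbeta b c v else 0 := by
  have hw : univ.filter (fun i => w i = false) = univ :=
    filter_true_of_mem fun i _ => eq_false_of_wt_eq_zero h i
  rw [deltaProd, hw]
  split_ifs with huv
  · subst huv
    simp [Pbeta]
  · obtain ⟨i, hi⟩ := Function.ne_iff.1 huv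
    exact prod_eq_zero (mem_univ i) (by simp [hi])

theorem sum_mul_fvec {m : ℕ} {a : ℂ} (ha : a ≠ 0) (b c : Fin m → ℂ) (v : Fin m → Bool)
    (F : (Fin m → Bool) → ℂ) :
    a * ∑ w, F w * fvec a b c v w =
      a * F v - ∑ j, (betaP b c (v j) j * F v + betaP b c (!(v j)) j * F (flipv j v)) := by
  have h : ∀ v', ∑ w, F w * evec v' w = F v' := fun v' => by simp [evec]
  have hf : ∑ w, F w * fvec a b c v w =
      (a - Sbeta b c v) / a * F v - ∑ j, betaP b c (!(v j)) j / a * F (flipv j v) := by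
    simp only [fvec, Pi.sub_apply, Pi.smul_apply, Finset.sum_apply, smul_eq_mul, mul_sub,
      sum_sub_distrib, mul_sum]
    rw [sum_comm]
    simp only [mul_left_comm (F _), ← mul_sum, h]
  rw [hf, mul_sub, mul_sum, sum_add_distrib, ← sum_mul, ← Sbeta, ← mul_assoc,
    mul_div_cancel₀ _ ha]
  simp only [← mul_assoc, mul_div_cancel₀ _ ha]
  ring

theorem gammaP_eq {m : ℕ} (a : ℂ) (c : Fin m → ℂ) (w : Fin m → Bool) :
    gammaP a c w = a - ∑ j, if w j = true then c j - 1 else 0 := by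
  have : ∀ j, (if w j = true then c j - 1 else 0) =
      (if w j = true then c j else 0) - if w j = true then 1 else 0 := fun j => by
    split_ifs <;> simp
  simp only [this, sum_sub_distrib, gammaP, wt]
  push_cast
  ring

theorem Cmat_mul_fvec {m : ℕ} {a : ℂ} {b c : Fin m → ℂ} (ha : a ≠ 0)
    (hb : ∀ s i, betaP b c s i ≠ 0) (hγ : ∀ w : Fin m → Bool, gammaP a c w ≠ 0)
    (u v : Fin m → Bool) :
    ∑ w, Cmat a b c u w * fvec a b c v w = 1 / Pbeta b c v * evec v u := by
  set A := Aw (gammaP a c) with hA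
  set T := fun w => deltaProd b c w u v with hT
  have hC : ∀ v', Cmat a b c u v' = ∑ w, A w * deltaProd b c w u v' := fun _ => rfl
  have hexpand : a * ∑ w, Cmat a b c u w * fvec a b c v w =
      ∑ w, A w * gammaP a c w * T w -
        ∑ w, ∑ j, (if w j = true then 0 else A w * T (flipv j w)) := by
    rw [sum_mul_fvec ha b c v (Cmat a b c u)]
    simp only [hC, mul_sum, ← sum_add_distrib]
    rw [sum_comm (s := univ (α := Fin m)), ← sum_sub_distrib, ← sum_sub_distrib]
    refine sum_congr rfl fun w _ => ?_
    have hj : ∀ j, betaP b c (v j) j * (A w * deltaProd b c w u v) +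
        betaP b c (!(v j)) j * (A w * deltaProd b c w u (flipv j v)) =
        A w * T w * (if w j = true then c j - 1 else 0) +
          (if w j = true then 0 else A w * T (flipv j w)) := fun j => by
      rw [mul_left_comm, mul_left_comm _ (A w), ← mul_add, deltaProd_flip_add hb]
      split_ifs <;> simp only [hT] <;> ring
    rw [sum_congr rfl fun j _ => hj j, sum_add_distrib, ← mul_sum, gammaP_eq]
    ring
  have hswap : ∑ w, ∑ j, (if w j = true then 0 else A w * T (flipv j w)) =
      ∑ w, (∑ j, if w j = true then A (flipv j w) else 0) * T w := by
    simp only [sum_mul]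
    rw [sum_comm, sum_comm (s := univ (α := Fin m → Bool))]
    refine sum_congr rfl fun j _ => ?_
    refine Fintype.sum_equiv (flipv_involutive j).toPerm _ _ fun w => ?_
    by_cases hj : w j = true <;>
      simp [flipv_same, (flipv_involutive j) w, hj]
  have hzero : wt (fun _ : Fin m => false) = 0 := by simp [wt]
  have hmain : a * ∑ w, Cmat a b c u w * fvec a b c v w = a * (1 / Pbeta b c v * evec v u) := by
    rw [hexpand, hswap, ← sum_sub_distrib, sum_eq_single (fun _ => false)]
    · simp [hA, hT, Aw_of_wt_eq_zero _ hzero, deltaProd_of_wt_eq_zero b c hzero, gammaP_eq, evec]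
    · intro w _ hw
      have hwt : wt w ≠ 0 := fun h => hw (funext (eq_false_of_wt_eq_zero h))
      rw [hA, Aw_recursion (hγ w) hwt, sub_self]
    · simp
  exact mul_left_cancel₀ ha hmain

theorem Pbeta_flipv {m : ℕ} (b c : Fin m → ℂ) (k : Fin m) (v : Fin m → Bool) :
    betaP b c (!(v k)) k * Pbeta b c v = betaP b c (v k) k * Pbeta b c (flipv k v) := by
  have h : ∏ i ∈ univ.erase k, betaP b c (flipv k v i) i = ∏ i ∈ univ.erase k, betaP b c (v i) i :=
    prod_congr rfl fun i hi => by rw [flipv_of_ne (ne_of_mem_erase hi)]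
  rw [Pbeta, Pbeta, ← mul_prod_erase _ _ (mem_univ k), ← mul_prod_erase univ _ (mem_univ k), h,
    flipv_same]
  ring

theorem Rmat_eq {m : ℕ} {b c : Fin m → ℂ} (hb : ∀ s i, betaP b c s i ≠ 0) (k : Fin m) :
    Rmat b c k = (1 - c k) • (1 : Matrix (Fin m → Bool) (Fin m → Bool) ℂ) +
      ∑ v ∈ univ.filter (fun v : Fin m → Bool => v k = false),
        (betaP b c true k * Pbeta b c v) •
          Matrix.vecMulVec
            (fun u => 1 / Pbeta b c v * evec v u - 1 / Pbeta b c (flipv k v) * evec (flipv k v) u)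
            (evec v - evec (flipv k v)) := by
  have hP : ∀ v, Pbeta b c v ≠ 0 := fun v => prod_ne_zero_iff.2 fun i _ => hb _ i
  have hck := betaP_add_betaP_not b c false k
  simp only [Bool.not_false] at hck
  have hterm : ∀ v ∈ univ.filter (fun v : Fin m → Bool => v k = false),
      (betaP b c true k * Pbeta b c v) •
          Matrix.vecMulVec
            (fun u => 1 / Pbeta b c v * evec v u - 1 / Pbeta b c (flipv k v) * evec (flipv k v) u)
            (evec v - evec (flipv k v)) =
        Matrix.vecMulVec
          (betaP b c true k • evec v - betaP b c false k • evec (flipv k v))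
          (evec v - evec (flipv k v)) := fun v hv => by
    have hvk : v k = false := (mem_filter.1 hv).2
    have hfl := Pbeta_flipv b c k v
    simp only [hvk, Bool.not_false] at hfl
    rw [← Matrix.smul_vecMulVec]
    congr 1
    funext u
    have h1 := hP v
    have h2 := hP (flipv k v)
    simp only [Pi.smul_apply, Pi.sub_apply, smul_eq_mul, mul_sub]
    congr 1
    · field_simp
    · rw [hfl]
      field_simp
  rw [sum_congr rfl hterm]
  ext u w
  simp only [Matrix.add_apply, Matrix.smul_apply, Matrix.sum_apply, Matrix.vecMulVec_apply,
    Pi.sub_apply, Pi.smul_apply, smul_eq_mul, Matrix.one_apply, Rmat]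
  have hflip : ∀ v, u = flipv k v ↔ v = flipv k u := fun v =>
    ⟨fun h => by rw [h, flipv_involutive k], fun h => by rw [h, flipv_involutive k]⟩
  have hne := flipv_ne k u
  simp only [evec, hflip, eq_comm (a := u)]
  cases huk : u k
  · rw [sum_eq_single_of_mem u (by simp [huk])]
    · by_cases hwu : w = u
      · simp [hwu, hne.symm]
        linear_combination -hck
      · by_cases hwf : w = flipv k u <;> simp [hwu, hne.symm, hne, hwf]
    · intro v hv hvu
      have : v ≠ flipv k u := by
        rintro rfl
        simp [flipv_same, huk] at hv
      simp [hvu, this]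
  · rw [sum_eq_single_of_mem (flipv k u) (by simp [flipv_same, huk])]
    · by_cases hwu : w = u
      · simp [hwu, hne.symm, hne, flipv_involutive k u]
        linear_combination -hck
      · by_cases hwf : w = flipv k u <;> simp [hwu, hne, hwf, flipv_involutive k u]
    · intro v hv hvu
      have : v ≠ u := by
        rintro rfl
        simp [huk] at hv
      simp [hvu, this]

/-- **Theorem 4.9 / Corollary 4.10 (coefficient of `dx_k`).** For every `k` and every
`x` with `x_k ≠ 0` and `1 − Σ v_i x_i ≠ 0` for all `v`:
`(1/x_k)·R_k + Σ_{v_k=1} (a/(1 − Σ v_i x_i))·e_vᵀ·f_v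
  = (1/x_k)·[(1 − c_k)·I + Σ_{v_k=0} β_{1,k}·Πβ_v·(C·(f_v − f_{σ_k·v})ᵀ)·(e_v − e_{σ_k·v})]
    + Σ_v v_k·(a·Πβ_v/(1 − Σ v_i x_i))·(C·f_vᵀ)·f_v`. -/
theorem stmt_15 (m : ℕ) (hm : 1 ≤ m) (a : ℂ) (b c : Fin m → ℂ) (ha : a ≠ 0)
    (hb0 : ∀ i, betaP b c false i ≠ 0) (hb1 : ∀ i, betaP b c true i ≠ 0)
    (hγ : ∀ w : Fin m → Bool, gammaP a c w ≠ 0) (k : Fin m) (x : Fin m → ℂ)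
    (hxk : x k ≠ 0) (hx : ∀ v : Fin m → Bool, 1 - ∑ i, bval (v i) * x i ≠ 0) :
    (1 / x k) • Rmat b c k +
        ∑ v ∈ univ.filter (fun v : Fin m → Bool => v k = true),
          (a / (1 - ∑ i, bval (v i) * x i)) •
            Matrix.vecMulVec (evec v) (fvec a b c v) =
      (1 / x k) •
          ((1 - c k) • (1 : Matrix (Fin m → Bool) (Fin m → Bool) ℂ) +
            ∑ v ∈ univ.filter (fun v : Fin m → Bool => v k = false),
              (betaP b c true k * Pbeta b c v) •
                Matrix.vecMulVec
                  (fun u => ∑ w, Cmat a b c u w *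
                    (fvec a b c v w - fvec a b c (flipv k v) w))
                  (evec v - evec (flipv k v))) +
        ∑ v : Fin m → Bool,
          ((if v k then 1 else 0 : ℂ) *
              (a * Pbeta b c v / (1 - ∑ i, bval (v i) * x i))) •
            Matrix.vecMulVec (fun u => ∑ w, Cmat a b c u w * fvec a b c v w)
              (fvec a b c v) := by
  have hb := betaP_ne_zero hb0 hb1
  have hP : ∀ v, Pbeta b c v ≠ 0 := fun v => prod_ne_zero_iff.2 fun i _ => hb _ i
  simp only [mul_sub, sum_sub_distrib, Cmat_mul_fvec ha hb hγ]
  rw [Rmat_eq hb k, sum_filter (fun v : Fin m → Bool => v k = true)]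
  congr 1
  refine sum_congr rfl fun v _ => ?_
  by_cases hv : v k = true
  · rw [if_pos hv, if_pos hv, one_mul]
    have hscale : (fun u => 1 / Pbeta b c v * evec v u) = (1 / Pbeta b c v) • evec v := rfl
    rw [hscale, Matrix.smul_vecMulVec, smul_smul]
    congr 1
    have h1 := hP v
    field_simp
  · simp [hv]
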